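/- Let U ⊆ ℝⁿ be open and let ∇ be a torsion-free affine connection on U with curvature R_{ab}^c_d, and assume ∇ is affine locally symmetric, i.e. ∇_a R_{bc}^d_e = 0 on U. Let σ_{bc} be a smooth symmetric 2-tensor field on U (σ_{bc} = σ_{cb}). Then σ is a Killing 2-tensor, i.e. the total symmetrization of ∇_a σ_{bc} over a, b, c vanishes on U, if and only if there exist smooth tensor fields μ_{bcd} and ρ_{bcde} on U with the symmetries μ_{bcd} = −μ_{bdc}, μ_{bcd} + μ_{cdb} + μ_{dbc} = 0, ρ_{bcde} = −ρ_{cbde}, ρ_{bcde} = −ρ_{bced}, ρ_{bcde} + ρ_{bdec} + ρ_{becd} = 0, such that on all of U: (i) ∇_a σ_{bc} + μ_{bca} + μ_{cba} = 0; (ii) ∇_a μ_{bcd} = (R◁σ)_{abcd} + ρ_{abcd}, where (R◁σ)_{abcd} := (2/3) R_{cd}^e_a σ_{be} − (1/3) R_{bc}^e_a σ_{de} + (1/3) R_{bd}^e_a σ_{ce}; and (iii) ∇_a ρ_{bcde} = (R⋄μ)_{abcde}, where (R⋄μ)_{abcde} := R_{bc}^f_a μ_{fde} + R_{de}^f_a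 μ_{fbc} − (1/2) R_{be}^f_a μ_{fcd} − (1/2) R_{cd}^f_a μ_{fbe} + (1/2) R_{bd}^f_a μ_{fce} + (1/2) R_{ce}^f_a μ_{fbd} + (2/3)( R_{a(b}^f_{d)} μ_{(ce)f} − R_{a(c}^f_{d)} μ_{(be)f} − R_{a(b}^f_{e)} μ_{(cd)f} + R_{a(c}^f_{e)} μ_{(bd)f} ) − (2/3)( R_{bc}^f_d μ_{(ea)f} − R_{bc}^f_e μ_{(da)f} + R_{de}^f_b μ_{(ca)f} − R_{de}^f_c μ_{(ba)f} ), with R_{a(b}^f_{d)} := (1/2)(R_{ab}^f_d + R_{ad}^f_b) and μ_{(ce)f} := (1/2)(μ_{cef} + μ_{ecf}), and contraction over the repeated index e (resp. f). Moreover, such μ and ρ are uniquely determined by σ. -/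

import Mathlib

open scoped BigOperators

noncomputable section

/-- Partial derivative in coordinate direction `a`. -/
def pd {n : ℕ} (a : Fin n) (f : (Fin n → ℝ) → ℝ) (x : Fin n → ℝ) : ℝ :=
  fderiv ℝ f x (Pi.single a 1)

/-- Curvature `R_{ab}ᶜ_d` of the affine connection with Christoffel symbols `Γ`. -/
def curv {n : ℕ} (Γ : Fin n → Fin n → Fin n → (Fin n → ℝ) → ℝ)
    (a b c d : Fin n) (x : Fin n → ℝ) : ℝ :=
  pd a (Γ b d c) x - pd b (Γ a d c) x +
    ∑ e, (Γ b d e x * Γ a e c x - Γ a d e x * Γ b e c x)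

/-- Covariant derivative `∇_a T_{bc}` of a covariant 2-tensor. -/
def cov2 {n : ℕ} (Γ : Fin n → Fin n → Fin n → (Fin n → ℝ) → ℝ)
    (a : Fin n) (T : Fin n → Fin n → (Fin n → ℝ) → ℝ) (b c : Fin n)
    (x : Fin n → ℝ) : ℝ :=
  pd a (T b c) x - ∑ e, Γ a b e x * T e c x - ∑ e, Γ a c e x * T b e x

/-- Covariant derivative `∇_a T_{bcd}` of a covariant 3-tensor. -/
def cov3 {n : ℕ} (Γ : Fin n → Fin n → Fin n → (Fin n → ℝ) → ℝ)
    (a : Fin n) (T : Fin n → Fin n → Fin n → (Fin n → ℝ) → ℝ) (b c d : Fin n)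
    (x : Fin n → ℝ) : ℝ :=
  pd a (T b c d) x - ∑ e, Γ a b e x * T e c d x - ∑ e, Γ a c e x * T b e d x
    - ∑ e, Γ a d e x * T b c e x

/-- Covariant derivative `∇_a T_{bcde}` of a covariant 4-tensor. -/
def cov4 {n : ℕ} (Γ : Fin n → Fin n → Fin n → (Fin n → ℝ) → ℝ)
    (a : Fin n) (T : Fin n → Fin n → Fin n → Fin n → (Fin n → ℝ) → ℝ)
    (b c d e : Fin n) (x : Fin n → ℝ) : ℝ :=
  pd a (T b c d e) x - ∑ f, Γ a b f x * T f c d e x - ∑ f, Γ a c f x * T b f d e x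
    - ∑ f, Γ a d f x * T b c f e x - ∑ f, Γ a e f x * T b c d f x

/-- Covariant derivative `∇_a R_{bc}ᵈ_e` of the curvature. -/
def covR {n : ℕ} (Γ : Fin n → Fin n → Fin n → (Fin n → ℝ) → ℝ)
    (a b c d e : Fin n) (x : Fin n → ℝ) : ℝ :=
  pd a (curv Γ b c d e) x - ∑ f, Γ a b f x * curv Γ f c d e x
    - ∑ f, Γ a c f x * curv Γ b f d e x + ∑ f, Γ a f d x * curv Γ b c f e x
    - ∑ f, Γ a e f x * curv Γ b c d f x

/-- `(R ◁ σ)_{abcd} = (2/3) R_{cd}ᵉ_a σ_{be} − (1/3) R_{bc}ᵉ_a σ_{de}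
  + (1/3) R_{bd}ᵉ_a σ_{ce}`. -/
def Rtri {n : ℕ} (Γ : Fin n → Fin n → Fin n → (Fin n → ℝ) → ℝ)
    (σ : Fin n → Fin n → (Fin n → ℝ) → ℝ) (a b c d : Fin n)
    (x : Fin n → ℝ) : ℝ :=
  (2/3 : ℝ) * ∑ e, curv Γ c d e a x * σ b e x
    - (1/3 : ℝ) * ∑ e, curv Γ b c e a x * σ d e x
    + (1/3 : ℝ) * ∑ e, curv Γ b d e a x * σ c e x

/-- `(R ⋄ μ)_{abcde}` as in the prolongation connection for Killing 2-tensors. -/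
def Rdia {n : ℕ} (Γ : Fin n → Fin n → Fin n → (Fin n → ℝ) → ℝ)
    (μ : Fin n → Fin n → Fin n → (Fin n → ℝ) → ℝ) (a b c d e : Fin n)
    (x : Fin n → ℝ) : ℝ :=
  (∑ f, curv Γ b c f a x * μ f d e x) + (∑ f, curv Γ d e f a x * μ f b c x)
  - (1/2 : ℝ) * ∑ f, curv Γ b e f a x * μ f c d x
  - (1/2 : ℝ) * ∑ f, curv Γ c d f a x * μ f b e x
  + (1/2 : ℝ) * ∑ f, curv Γ b d f a x * μ f c e x
  + (1/2 : ℝ) * ∑ f, curv Γ c e f a x * μ f b d x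
  + (2/3 : ℝ) *
    ( (∑ f, ((curv Γ a b f d x + curv Γ a d f b x) / 2) * ((μ c e f x + μ e c f x) / 2))
    - (∑ f, ((curv Γ a c f d x + curv Γ a d f c x) / 2) * ((μ b e f x + μ e b f x) / 2))
    - (∑ f, ((curv Γ a b f e x + curv Γ a e f b x) / 2) * ((μ c d f x + μ d c f x) / 2))
    + (∑ f, ((curv Γ a c f e x + curv Γ a e f c x) / 2) * ((μ b d f x + μ d b f x) / 2)) )
  - (2/3 : ℝ) *
    ( (∑ f, curv Γ b c f d x * ((μ e a f x + μ a e f x) / 2))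
    - (∑ f, curv Γ b c f e x * ((μ d a f x + μ a d f x) / 2))
    + (∑ f, curv Γ d e f b x * ((μ c a f x + μ a c f x) / 2))
    - (∑ f, curv Γ d e f c x * ((μ b a f x + μ a b f x) / 2)) )

/-- The conditions on the prolonged variables `(μ, ρ)` of a Killing 2-tensor `σ`:
symmetries, smoothness, and the three equations of the prolongation connection. -/
def KTwoProlonged {n : ℕ} (U : Set (Fin n → ℝ))
    (Γ : Fin n → Fin n → Fin n → (Fin n → ℝ) → ℝ)
    (σ : Fin n → Fin n → (Fin n → ℝ) → ℝ)
    (μ : Fin n → Fin n → Fin n → (Fin n → ℝ) → ℝ)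
    (ρ : Fin n → Fin n → Fin n → Fin n → (Fin n → ℝ) → ℝ) : Prop :=
  (∀ b c d, ContDiffOn ℝ (⊤ : ℕ∞) (μ b c d) U) ∧
  (∀ b c d e, ContDiffOn ℝ (⊤ : ℕ∞) (ρ b c d e) U) ∧
  (∀ b c d, ∀ x ∈ U, μ b c d x = - μ b d c x) ∧
  (∀ b c d, ∀ x ∈ U, μ b c d x + μ c d b x + μ d b c x = 0) ∧
  (∀ b c d e, ∀ x ∈ U, ρ b c d e x = - ρ c b d e x) ∧
  (∀ b c d e, ∀ x ∈ U, ρ b c d e x = - ρ b c e d x) ∧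
  (∀ b c d e, ∀ x ∈ U, ρ b c d e x + ρ b d e c x + ρ b e c d x = 0) ∧
  (∀ a b c, ∀ x ∈ U, cov2 Γ a σ b c x + μ b c a x + μ c b a x = 0) ∧
  (∀ a b c d, ∀ x ∈ U, cov3 Γ a μ b c d x = Rtri Γ σ a b c d x + ρ a b c d x) ∧
  (∀ a b c d e, ∀ x ∈ U, cov4 Γ a ρ b c d e x = Rdia Γ μ a b c d e x)

section PartialDerivatives

variable {n : ℕ} {U : Set (Fin n → ℝ)} {x : Fin n → ℝ} {f g : (Fin n → ℝ) → ℝ}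

theorem ContDiffOn.differentiableAt_of_isOpen (hf : ContDiffOn ℝ (⊤ : ℕ∞) f U) (hU : IsOpen U)
    (hx : x ∈ U) : DifferentiableAt ℝ f x :=
  (hf.contDiffAt (hU.mem_nhds hx)).differentiableAt (by simp)

theorem ContDiffOn.pd (hf : ContDiffOn ℝ (⊤ : ℕ∞) f U) (hU : IsOpen U) (a : Fin n) :
    ContDiffOn ℝ (⊤ : ℕ∞) (pd a f) U :=
  (hf.fderiv_of_isOpen hU (by simp)).clm_apply contDiffOn_const

theorem pd_congr (hU : IsOpen U) (h : ∀ y ∈ U, f y = g y) (hx : x ∈ U) (a : Fin n) :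
    pd a f x = pd a g x := by
  have : f =ᶠ[nhds x] g := Filter.eventuallyEq_of_mem (hU.mem_nhds hx) h
  simp only [pd, this.fderiv_eq]

theorem pd_add (hf : DifferentiableAt ℝ f x) (hg : DifferentiableAt ℝ g x) (a : Fin n) :
    pd a (fun y => f y + g y) x = pd a f x + pd a g x := by
  simp only [pd, fderiv_fun_add hf hg, _root_.add_apply]

theorem pd_sub (hf : DifferentiableAt ℝ f x) (hg : DifferentiableAt ℝ g x) (a : Fin n) :
    pd a (fun y => f y - g y) x = pd a f x - pd a g x := by
  simp only [pd, fderiv_fun_sub hf hg, _root_.sub_apply]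

theorem pd_neg (a : Fin n) : pd a (fun y => -f y) x = -pd a f x := by
  simp only [pd, fderiv_fun_neg, _root_.neg_apply]

theorem pd_const_mul (hf : DifferentiableAt ℝ f x) (r : ℝ) (a : Fin n) :
    pd a (fun y => r * f y) x = r * pd a f x := by
  simp only [pd, fderiv_const_mul hf, _root_.smul_apply, smul_eq_mul]

theorem pd_sum_mul {ι : Type*} {s : Finset ι} {F G : ι → (Fin n → ℝ) → ℝ}
    (hF : ∀ i, DifferentiableAt ℝ (F i) x) (hG : ∀ i, DifferentiableAt ℝ (G i) x) (a : Fin n) :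
    pd a (fun y => ∑ i ∈ s, F i y * G i y) x =
      ∑ i ∈ s, (pd a (F i) x * G i x + F i x * pd a (G i) x) := by
  simp only [pd]
  rw [fderiv_fun_sum (fun i _ => (hF i).fun_mul (hG i)), _root_.sum_apply]
  refine Finset.sum_congr rfl fun i _ => ?_
  rw [fderiv_fun_mul (hF i) (hG i)]
  simp only [_root_.add_apply, _root_.smul_apply, smul_eq_mul]
  ring

theorem pd_comm (hf : ContDiffOn ℝ (⊤ : ℕ∞) f U) (hU : IsOpen U) (hx : x ∈ U) (a b : Fin n) :
    pd a (pd b f) x = pd b (pd a f) x := by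
  have hd : DifferentiableAt ℝ (fderiv ℝ f) x :=
    ((hf.fderiv_of_isOpen hU (m := 1) (by norm_cast)).contDiffAt
      (hU.mem_nhds hx)).differentiableAt (by simp)
  have key : ∀ c d : Fin n, pd c (pd d f) x =
      fderiv ℝ (fderiv ℝ f) x (Pi.single c 1) (Pi.single d 1) := by
    intro c d
    change fderiv ℝ (fun y => fderiv ℝ f y (Pi.single d 1)) x (Pi.single c 1) = _
    rw [fderiv_clm_apply hd (by fun_prop)]
    simp
  have hs : IsSymmSndFDerivAt ℝ f x :=
    (hf.contDiffAt (hU.mem_nhds hx)).isSymmSndFDerivAt (by simp; norm_cast)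
  rw [key, key]
  exact hs _ _

end PartialDerivatives

section Connection

variable {n : ℕ} {U : Set (Fin n → ℝ)} {x : Fin n → ℝ}
  {Γ : Fin n → Fin n → Fin n → (Fin n → ℝ) → ℝ}
  {S : Fin n → Fin n → (Fin n → ℝ) → ℝ}
  {T : Fin n → Fin n → Fin n → (Fin n → ℝ) → ℝ}

theorem ContDiffOn.curv (hU : IsOpen U) (hΓ : ∀ a b c, ContDiffOn ℝ (⊤ : ℕ∞) (Γ a b c) U)
    (a b c d : Fin n) : ContDiffOn ℝ (⊤ : ℕ∞) (curv Γ a b c d) U :=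
  (((hΓ _ _ _).pd hU _).sub ((hΓ _ _ _).pd hU _)).add <| ContDiffOn.sum fun _ _ =>
    ((hΓ _ _ _).mul (hΓ _ _ _)).sub ((hΓ _ _ _).mul (hΓ _ _ _))

theorem ContDiffOn.cov2 (hU : IsOpen U) (hΓ : ∀ a b c, ContDiffOn ℝ (⊤ : ℕ∞) (Γ a b c) U)
    (hS : ∀ b c, ContDiffOn ℝ (⊤ : ℕ∞) (S b c) U) (a b c : Fin n) :
    ContDiffOn ℝ (⊤ : ℕ∞) (cov2 Γ a S b c) U :=
  (((hS _ _).pd hU _).sub (ContDiffOn.sum fun _ _ => (hΓ _ _ _).mul (hS _ _))).sub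
    (ContDiffOn.sum fun _ _ => (hΓ _ _ _).mul (hS _ _))

theorem ContDiffOn.cov3 (hU : IsOpen U) (hΓ : ∀ a b c, ContDiffOn ℝ (⊤ : ℕ∞) (Γ a b c) U)
    (hT : ∀ b c d, ContDiffOn ℝ (⊤ : ℕ∞) (T b c d) U) (a b c d : Fin n) :
    ContDiffOn ℝ (⊤ : ℕ∞) (cov3 Γ a T b c d) U :=
  ((((hT _ _ _).pd hU _).sub (ContDiffOn.sum fun _ _ => (hΓ _ _ _).mul (hT _ _ _))).sub
    (ContDiffOn.sum fun _ _ => (hΓ _ _ _).mul (hT _ _ _))).sub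
    (ContDiffOn.sum fun _ _ => (hΓ _ _ _).mul (hT _ _ _))

theorem ContDiffOn.Rtri (hU : IsOpen U) (hΓ : ∀ a b c, ContDiffOn ℝ (⊤ : ℕ∞) (Γ a b c) U)
    (hS : ∀ b c, ContDiffOn ℝ (⊤ : ℕ∞) (S b c) U) (a b c d : Fin n) :
    ContDiffOn ℝ (⊤ : ℕ∞) (Rtri Γ S a b c d) U := by
  have h : ∀ i j k l, ContDiffOn ℝ (⊤ : ℕ∞) (fun y => ∑ e, _root_.curv Γ i j e k y * S l e y) U :=
    fun i j k l => ContDiffOn.sum fun e _ => (ContDiffOn.curv hU hΓ i j e k).mul (hS l e)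
  exact ((contDiffOn_const.mul (h c d a b)).sub (contDiffOn_const.mul (h b c a d))).add
    (contDiffOn_const.mul (h b d a c))

theorem curv_antisymm (a b c d : Fin n) : curv Γ a b c d x = -curv Γ b a c d x := by
  simp only [curv, Finset.sum_sub_distrib]
  ring

theorem curv_bianchi (hU : IsOpen U) (hsym : ∀ a b c, ∀ y ∈ U, Γ a b c y = Γ b a c y)
    (hx : x ∈ U) (a b c d : Fin n) :
    curv Γ a b d c x + curv Γ b c d a x + curv Γ c a d b x = 0 := by
  have hpd : ∀ i j k, pd k (Γ i j d) x = pd k (Γ j i d) x := fun i j k =>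
    pd_congr hU (fun y hy => hsym i j d y hy) hx k
  have hs : ∀ i j k e, ∑ f, Γ i j f x * Γ k f e x = ∑ f, Γ j i f x * Γ k f e x :=
    fun i j k e => Finset.sum_congr rfl fun f _ => by rw [hsym i j f x hx]
  simp only [curv, Finset.sum_sub_distrib]
  linear_combination hpd b c a + hpd c a b + hpd a b c + hs b c a d + hs c a b d + hs a b c d

theorem sum_mul_curv {t : Fin n → ℝ} (a b c : Fin n) :
    ∑ e, curv Γ a b e c x * t e =
      ∑ e, pd a (Γ b c e) x * t e - ∑ e, pd b (Γ a c e) x * t e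
        + ∑ f, Γ b c f x * ∑ e, Γ a f e x * t e - ∑ f, Γ a c f x * ∑ e, Γ b f e x * t e := by
  have h : ∀ i j, ∑ f, Γ i c f x * ∑ e, Γ j f e x * t e =
      ∑ e, (∑ f, Γ i c f x * Γ j f e x) * t e := by
    intro i j
    simp only [Finset.mul_sum, Finset.sum_mul]
    rw [Finset.sum_comm]
    simp only [mul_assoc]
  rw [h, h]
  simp only [curv, Finset.sum_sub_distrib, add_mul, sub_mul, Finset.sum_add_distrib]
  ring

theorem sum_mul_sum_mul_comm (p q : Fin n → ℝ) (t : Fin n → Fin n → ℝ) :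
    ∑ e, p e * ∑ f, q f * t e f = ∑ f, q f * ∑ e, p e * t e f := by
  simp only [Finset.mul_sum]
  rw [Finset.sum_comm]
  exact Finset.sum_congr rfl fun _ _ => Finset.sum_congr rfl fun _ _ => by ring

/-- The Ricci identity for covariant 2-tensors. The covariant derivatives are iterated without
regard to the first derivative index, whose contribution is symmetric for a torsion-free
connection. -/
theorem ricci_cov2 (hU : IsOpen U) (hΓ : ∀ a b c, ContDiffOn ℝ (⊤ : ℕ∞) (Γ a b c) U)
    (hS : ∀ b c, ContDiffOn ℝ (⊤ : ℕ∞) (S b c) U) (hx : x ∈ U) (a b c d : Fin n) :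
    cov2 Γ a (cov2 Γ b S) c d x - cov2 Γ b (cov2 Γ a S) c d x =
      -∑ e, curv Γ a b e c x * S e d x - ∑ e, curv Γ a b e d x * S c e x := by
  have dΓ : ∀ i j k, DifferentiableAt ℝ (Γ i j k) x := fun i j k =>
    (hΓ i j k).differentiableAt_of_isOpen hU hx
  have dS : ∀ i j, DifferentiableAt ℝ (S i j) x := fun i j =>
    (hS i j).differentiableAt_of_isOpen hU hx
  have dpS : ∀ i j k, DifferentiableAt ℝ (pd k (S i j)) x := fun i j k =>
    ((hS i j).pd hU k).differentiableAt_of_isOpen hU hx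
  have key : ∀ i j, pd i (cov2 Γ j S c d) x = pd i (pd j (S c d)) x
      - ∑ e, (pd i (Γ j c e) x * S e d x + Γ j c e x * pd i (S e d) x)
      - ∑ e, (pd i (Γ j d e) x * S c e x + Γ j d e x * pd i (S c e) x) := by
    intro i j
    change pd i (fun y => pd j (S c d) y - ∑ e, Γ j c e y * S e d y - ∑ e, Γ j d e y * S c e y) x
      = _
    rw [pd_sub (by fun_prop) (by fun_prop), pd_sub (by fun_prop) (by fun_prop),
      pd_sum_mul (by fun_prop) (by fun_prop), pd_sum_mul (by fun_prop) (by fun_prop)]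
  rw [cov2, cov2, key, key, sum_mul_curv, sum_mul_curv]
  simp only [cov2, mul_sub, Finset.sum_sub_distrib, Finset.sum_add_distrib]
  linear_combination pd_comm (hS c d) hU hx a b
    + sum_mul_sum_mul_comm (fun e => Γ a c e x) (fun e => Γ b d e x) (fun e f => S e f x)
    - sum_mul_sum_mul_comm (fun e => Γ b c e x) (fun e => Γ a d e x) (fun e f => S e f x)

/-- The Ricci identity for covariant 3-tensors, with the same convention as `ricci_cov2`. -/
theorem ricci_cov3 (hU : IsOpen U) (hΓ : ∀ a b c, ContDiffOn ℝ (⊤ : ℕ∞) (Γ a b c) U)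
    (hT : ∀ b c d, ContDiffOn ℝ (⊤ : ℕ∞) (T b c d) U) (hx : x ∈ U) (a b c d e : Fin n) :
    cov3 Γ a (cov3 Γ b T) c d e x - cov3 Γ b (cov3 Γ a T) c d e x =
      -∑ f, curv Γ a b f c x * T f d e x - ∑ f, curv Γ a b f d x * T c f e x
        - ∑ f, curv Γ a b f e x * T c d f x := by
  have dΓ : ∀ i j k, DifferentiableAt ℝ (Γ i j k) x := fun i j k =>
    (hΓ i j k).differentiableAt_of_isOpen hU hx
  have dT : ∀ i j k, DifferentiableAt ℝ (T i j k) x := fun i j k =>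
    (hT i j k).differentiableAt_of_isOpen hU hx
  have dpT : ∀ i j k l, DifferentiableAt ℝ (pd l (T i j k)) x := fun i j k l =>
    ((hT i j k).pd hU l).differentiableAt_of_isOpen hU hx
  have key : ∀ i j, pd i (cov3 Γ j T c d e) x = pd i (pd j (T c d e)) x
      - ∑ f, (pd i (Γ j c f) x * T f d e x + Γ j c f x * pd i (T f d e) x)
      - ∑ f, (pd i (Γ j d f) x * T c f e x + Γ j d f x * pd i (T c f e) x)
      - ∑ f, (pd i (Γ j e f) x * T c d f x + Γ j e f x * pd i (T c d f) x) := by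
    intro i j
    change pd i (fun y => pd j (T c d e) y - ∑ f, Γ j c f y * T f d e y
      - ∑ f, Γ j d f y * T c f e y - ∑ f, Γ j e f y * T c d f y) x = _
    rw [pd_sub (by fun_prop) (by fun_prop), pd_sub (by fun_prop) (by fun_prop),
      pd_sub (by fun_prop) (by fun_prop),
      pd_sum_mul (by fun_prop) (by fun_prop), pd_sum_mul (by fun_prop) (by fun_prop),
      pd_sum_mul (by fun_prop) (by fun_prop)]
  rw [cov3, cov3, key, key, sum_mul_curv, sum_mul_curv, sum_mul_curv]
  simp only [cov3, mul_sub, Finset.sum_sub_distrib, Finset.sum_add_distrib]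
  linear_combination pd_comm (hT c d e) hU hx a b
    + sum_mul_sum_mul_comm (fun f => Γ a c f x) (fun f => Γ b d f x) (fun f g => T f g e x)
    - sum_mul_sum_mul_comm (fun f => Γ b c f x) (fun f => Γ a d f x) (fun f g => T f g e x)
    + sum_mul_sum_mul_comm (fun f => Γ a c f x) (fun f => Γ b e f x) (fun f g => T f d g x)
    - sum_mul_sum_mul_comm (fun f => Γ b c f x) (fun f => Γ a e f x) (fun f g => T f d g x)
    + sum_mul_sum_mul_comm (fun f => Γ a d f x) (fun f => Γ b e f x) (fun f g => T c f g x)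
    - sum_mul_sum_mul_comm (fun f => Γ b d f x) (fun f => Γ a e f x) (fun f g => T c f g x)

/-- Leibniz rule for the contraction of a parallel curvature with a 2-tensor. -/
theorem cov4_curv_contract (hU : IsOpen U)
    (hΓ : ∀ a b c, ContDiffOn ℝ (⊤ : ℕ∞) (Γ a b c) U)
    (hS : ∀ b c, ContDiffOn ℝ (⊤ : ℕ∞) (S b c) U) (hx : x ∈ U)
    (hR : ∀ a b c d e, covR Γ a b c d e x = 0) (a b c d e : Fin n) :
    cov4 Γ a (fun b c d e y => ∑ f, curv Γ b c f d y * S e f y) b c d e x =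
      ∑ f, curv Γ b c f d x * cov2 Γ a S e f x := by
  have dR : ∀ i j k l, DifferentiableAt ℝ (curv Γ i j k l) x := fun i j k l =>
    (ContDiffOn.curv hU hΓ i j k l).differentiableAt_of_isOpen hU hx
  have dS : ∀ i j, DifferentiableAt ℝ (S i j) x := fun i j =>
    (hS i j).differentiableAt_of_isOpen hU hx
  have hR' : ∀ f, pd a (curv Γ b c f d) x = ∑ g, Γ a b g x * curv Γ g c f d x
      + ∑ g, Γ a c g x * curv Γ b g f d x - ∑ g, Γ a g f x * curv Γ b c g d x
      + ∑ g, Γ a d g x * curv Γ b c f g x := fun f => by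
    have := hR a b c f d
    rw [covR] at this
    linarith
  have move : ∀ (p : Fin n → ℝ) (r : Fin n → Fin n → ℝ) (t : Fin n → ℝ),
      ∑ f, (∑ g, p g * r g f) * t f = ∑ g, p g * ∑ f, r g f * t f := by
    intro p r t
    simp only [Finset.mul_sum, Finset.sum_mul]
    rw [Finset.sum_comm]
    simp only [mul_assoc]
  have up : ∑ f, (∑ g, Γ a g f x * curv Γ b c g d x) * S e f x =
      ∑ f, curv Γ b c f d x * ∑ g, Γ a f g x * S e g x := by
    simp only [Finset.mul_sum, Finset.sum_mul]
    rw [Finset.sum_comm]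
    exact Finset.sum_congr rfl fun _ _ => Finset.sum_congr rfl fun _ _ => by ring
  have last := sum_mul_sum_mul_comm (fun f => curv Γ b c f d x) (fun g => Γ a e g x)
    (fun f g => S g f x)
  rw [cov4, pd_sum_mul (by fun_prop) (by fun_prop)]
  simp only [hR', cov2, mul_sub, add_mul, sub_mul, Finset.sum_sub_distrib,
    Finset.sum_add_distrib, move, up]
  linear_combination last

end Connection

/-- Algebraic identity behind the prolongation equation for `ρ`: a tensor skew in its second and
third indices is recovered from its skew part in the first two, here expressed through the
contraction `L i j k l m = ∑ f, R_{ij}ᶠ_k μ_{lmf}`. -/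
theorem eq_of_skew_part_eq {ι : Type*} {X L : ι → ι → ι → ι → ι → ℝ}
    (hA : ∀ i j k l m, L i j k l m + L j i k l m = 0)
    (hB : ∀ i j k l m, L i j k l m + L j k i l m + L k i j l m = 0)
    (hX : ∀ a b c d e, X a b c d e + X a c b d e = 0)
    (hQ : ∀ a b c d e, X a b c d e - X b a c d e =
      -(L a b c e d - L a b c d e) + L a b d c e - L a b e c d
      - (2 / 3 * (2 * L d e b c a - L d e b a c) - 1 / 3 * (2 * L c d b e a - L c d b a e)
        + 1 / 3 * (2 * L c e b d a - L c e b a d))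
      + (2 / 3 * (2 * L d e a c b - L d e a b c) - 1 / 3 * (2 * L c d a e b - L c d a b e)
        + 1 / 3 * (2 * L c e a d b - L c e a b d)))
    (a b c d e : ι) :
    X a b c d e =
      (L b c a e d - L b c a d e) + (L d e a c b - L d e a b c)
      - 1 / 2 * (L b e a d c - L b e a c d) - 1 / 2 * (L c d a e b - L c d a b e)
      + 1 / 2 * (L b d a e c - L b d a c e) + 1 / 2 * (L c e a d b - L c e a b d)
      + 2 / 3 * (1 / 4 * (L a b d c e + L a b d e c + L a d b c e + L a d b e c)
        - 1 / 4 * (L a c d b e + L a c d e b + L a d c b e + L a d c e b)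
        - 1 / 4 * (L a b e c d + L a b e d c + L a e b c d + L a e b d c)
        + 1 / 4 * (L a c e b d + L a c e d b + L a e c b d + L a e c d b))
      - 2 / 3 * (1 / 2 * (L b c d e a + L b c d a e) - 1 / 2 * (L b c e d a + L b c e a d)
        + 1 / 2 * (L d e b c a + L d e b a c) - 1 / 2 * (L d e c b a + L d e c a b)) := by
  linear_combination 1 / 2 * hQ a b c d e + 1 / 2 * hQ c a b d e - 1 / 2 * hQ b c a d e
      + 1 / 2 * hX a b c d e + 1 / 2 * hX b a c d e - 1 / 2 * hX c a b d e
      + 1 / 2 * hA c a d b e - 1 / 2 * hA c a e b d - 1 / 3 * hA d a b c e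
      + 1 / 6 * hA d a b e c + 1 / 3 * hA d a c b e - 1 / 6 * hA d a c e b
      + 1 / 6 * hA d b c a e - 1 / 3 * hA d b c e a + 1 / 3 * hA e a b c d
      - 1 / 6 * hA e a b d c - 1 / 3 * hA e a c b d + 1 / 6 * hA e a c d b
      - 1 / 6 * hA e b c a d + 1 / 3 * hA e b c d a + 1 / 2 * hB b c a d e
      - 1 / 2 * hB b c a e d + 1 / 3 * hB b d a c e - 1 / 6 * hB b d a e c
      - 1 / 3 * hB b e a c d + 1 / 6 * hB b e a d c - 1 / 3 * hB c d a b e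
      + 1 / 6 * hB c d a e b - 1 / 6 * hB c d b a e + 1 / 3 * hB c d b e a
      + 1 / 3 * hB c e a b d - 1 / 6 * hB c e a d b + 1 / 6 * hB c e b a d
      - 1 / 3 * hB c e b d a

/-- Algebraic identity behind the skew symmetry of `ρ`, for the second derivatives
`D a b c d = ∇_a ∇_b σ_{cd}` of a Killing tensor and `P i j k l = ∑ f, R_{ij}ᶠ_k σ_{lf}`. -/
theorem killing_hessian_skew {ι : Type*} {D P : ι → ι → ι → ι → ℝ}
    (hA : ∀ i j k l, P i j k l + P j i k l = 0)
    (hB : ∀ i j k l, P i j k l + P j k i l + P k i j l = 0)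
    (hS : ∀ a b c d, D a b c d = D a b d c)
    (hK : ∀ a b c d, D a b c d + D a c d b + D a d b c = 0)
    (hC : ∀ a b c d, D a b c d - D b a c d = -P a b c d - P a b d c)
    (a b c d : ι) :
    -(1 / 3) * (D a d b c - D a c b d)
        - (2 / 3 * P c d a b - 1 / 3 * P b c a d + 1 / 3 * P b d a c) =
      -(-(1 / 3) * (D b d a c - D b c a d)
        - (2 / 3 * P c d b a - 1 / 3 * P a c b d + 1 / 3 * P a d b c)) := by
  grind

section Prolongation

variable {n : ℕ} {U : Set (Fin n → ℝ)} {x : Fin n → ℝ}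
  {Γ : Fin n → Fin n → Fin n → (Fin n → ℝ) → ℝ}
  {σ : Fin n → Fin n → (Fin n → ℝ) → ℝ}
  {μ : Fin n → Fin n → Fin n → (Fin n → ℝ) → ℝ}

theorem cov4_Rtri (hU : IsOpen U) (hΓ : ∀ a b c, ContDiffOn ℝ (⊤ : ℕ∞) (Γ a b c) U)
    (hσ : ∀ b c, ContDiffOn ℝ (⊤ : ℕ∞) (σ b c) U) (hx : x ∈ U)
    (hR : ∀ a b c d e, covR Γ a b c d e x = 0) (a b c d e : Fin n) :
    cov4 Γ a (Rtri Γ σ) b c d e x =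
      (2/3 : ℝ) * ∑ f, curv Γ d e f b x * cov2 Γ a σ c f x
        - (1/3 : ℝ) * ∑ f, curv Γ c d f b x * cov2 Γ a σ e f x
        + (1/3 : ℝ) * ∑ f, curv Γ c e f b x * cov2 Γ a σ d f x := by
  have dP : ∀ i j k l, DifferentiableAt ℝ (fun y => ∑ f, curv Γ i j f k y * σ l f y) x :=
    fun i j k l => (ContDiffOn.sum fun f _ =>
      (ContDiffOn.curv hU hΓ i j f k).mul (hσ l f)).differentiableAt_of_isOpen hU hx
  rw [← cov4_curv_contract hU hΓ hσ hx hR a d e b c, ← cov4_curv_contract hU hΓ hσ hx hR a c d b e,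
    ← cov4_curv_contract hU hΓ hσ hx hR a c e b d]
  have hpd : pd a (Rtri Γ σ b c d e) x =
      2 / 3 * pd a (fun y => ∑ f, curv Γ d e f b y * σ c f y) x
        - 1 / 3 * pd a (fun y => ∑ f, curv Γ c d f b y * σ e f y) x
        + 1 / 3 * pd a (fun y => ∑ f, curv Γ c e f b y * σ d f y) x := by
    rw [← pd_const_mul (dP d e b c), ← pd_const_mul (dP c d b e), ← pd_const_mul (dP c e b d),
      ← pd_sub ((dP d e b c).const_mul _) ((dP c d b e).const_mul _),
      ← pd_add (((dP d e b c).const_mul _).fun_sub ((dP c d b e).const_mul _))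
        ((dP c e b d).const_mul _)]
    rfl
  have hs : ∀ p u v w : Fin n → ℝ, ∑ f, p f * (2 / 3 * u f - 1 / 3 * v f + 1 / 3 * w f) =
      2 / 3 * ∑ f, p f * u f - 1 / 3 * ∑ f, p f * v f + 1 / 3 * ∑ f, p f * w f := by
    intro p u v w
    simp only [Finset.mul_sum, ← Finset.sum_sub_distrib, ← Finset.sum_add_distrib]
    exact Finset.sum_congr rfl fun _ _ => by ring
  simp only [cov4, hpd]
  simp only [Rtri, hs]
  ring

/-- Third-order step of the prolongation: once `∇μ - R ◁ σ` is skew in its first two indices,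
its covariant derivative is `R ⋄ μ`. -/
theorem cov4_eq_Rdia (hU : IsOpen U) (hΓ : ∀ a b c, ContDiffOn ℝ (⊤ : ℕ∞) (Γ a b c) U)
    (hsym : ∀ a b c, ∀ y ∈ U, Γ a b c y = Γ b a c y)
    (hσ : ∀ b c, ContDiffOn ℝ (⊤ : ℕ∞) (σ b c) U)
    (hμ : ∀ b c d, ContDiffOn ℝ (⊤ : ℕ∞) (μ b c d) U) (hx : x ∈ U)
    (hR : ∀ a b c d e, covR Γ a b c d e x = 0)
    (hskew : ∀ b c d, μ b c d x = -μ b d c x)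
    (hcyc : ∀ b c d, μ b c d x + μ c d b x + μ d b c x = 0)
    (hσμ : ∀ a b c, cov2 Γ a σ b c x + μ b c a x + μ c b a x = 0)
    (hρ : ∀ b c d e, ∀ y ∈ U, cov3 Γ b μ c d e y - Rtri Γ σ b c d e y =
      -(cov3 Γ c μ b d e y - Rtri Γ σ c b d e y)) (a b c d e : Fin n) :
    cov4 Γ a (fun b c d e y => cov3 Γ b μ c d e y - Rtri Γ σ b c d e y) b c d e x =
      Rdia Γ μ a b c d e x := by
  set ρ : Fin n → Fin n → Fin n → Fin n → (Fin n → ℝ) → ℝ :=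
    fun b c d e y => cov3 Γ b μ c d e y - Rtri Γ σ b c d e y with hρdef
  let L : Fin n → Fin n → Fin n → Fin n → Fin n → ℝ :=
    fun i j k l m => ∑ f, curv Γ i j f k x * μ l m f x
  have hL₁ : ∀ i j k l m, ∑ f, curv Γ i j f k x * μ f l m x = L i j k m l - L i j k l m := by
    intro i j k l m
    simp only [L, ← Finset.sum_sub_distrib]
    refine Finset.sum_congr rfl fun f _ => ?_
    linear_combination curv Γ i j f k x * (hcyc f l m - hskew m f l)
  have hL₂ : ∀ i j k l m, ∑ f, curv Γ i j f k x * μ l f m x = -L i j k l m := by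
    intro i j k l m
    simp only [L, ← Finset.sum_neg_distrib]
    refine Finset.sum_congr rfl fun f _ => ?_
    rw [hskew l f m]
    ring
  have hL₃ : ∀ i j k l m, ∑ f, curv Γ i j f k x * μ l m f x = L i j k l m := fun _ _ _ _ _ => rfl
  have hL₄ : ∀ i j k l a, ∑ f, curv Γ i j f k x * cov2 Γ a σ l f x =
      2 * L i j k l a - L i j k a l := by
    intro i j k l a
    have h : ∀ f, cov2 Γ a σ l f x = -(μ l f a x + μ f l a x) := fun f => by
      linear_combination hσμ a l f
    simp only [h, mul_neg, mul_add, Finset.sum_neg_distrib, Finset.sum_add_distrib, hL₁, hL₂]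
    ring
  have hL₅ : ∀ i j k l m, ∑ f, curv Γ i j f k x * ((μ l m f x + μ m l f x) / 2) =
      1 / 2 * (L i j k l m + L i j k m l) := by
    intro i j k l m
    simp only [L, Finset.mul_sum, ← Finset.sum_add_distrib]
    exact Finset.sum_congr rfl fun _ _ => by ring
  have hL₆ : ∀ i j k l m, ∑ f, (curv Γ i j f k x + curv Γ i k f j x) / 2 *
      ((μ l m f x + μ m l f x) / 2) =
      1 / 4 * (L i j k l m + L i j k m l + L i k j l m + L i k j m l) := by
    intro i j k l m
    simp only [L, Finset.mul_sum, ← Finset.sum_add_distrib]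
    exact Finset.sum_congr rfl fun _ _ => by ring
  have hA : ∀ i j k l m, L i j k l m + L j i k l m = 0 := by
    intro i j k l m
    simp only [L, ← Finset.sum_add_distrib]
    refine Finset.sum_eq_zero fun f _ => ?_
    rw [curv_antisymm]
    ring
  have hB : ∀ i j k l m, L i j k l m + L j k i l m + L k i j l m = 0 := by
    intro i j k l m
    simp only [L, ← Finset.sum_add_distrib]
    refine Finset.sum_eq_zero fun f _ => ?_
    linear_combination μ l m f x * curv_bianchi hU hsym hx i j k f
  have hX : ∀ a b c d e, cov4 Γ a ρ b c d e x + cov4 Γ a ρ c b d e x = 0 := by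
    intro a b c d e
    have hpd : pd a (ρ b c d e) x = -pd a (ρ c b d e) x := by
      rw [← pd_neg]
      exact pd_congr hU (fun y hy => hρ b c d e y hy) hx a
    have hs : ∀ (p : Fin n → ℝ) (u v w z : Fin n → Fin n),
        ∑ f, p f * ρ (u f) (v f) (w f) (z f) x = -∑ f, p f * ρ (v f) (u f) (w f) (z f) x := by
      intro p u v w z
      rw [← Finset.sum_neg_distrib]
      exact Finset.sum_congr rfl fun f _ => by
        rw [show ρ (u f) (v f) (w f) (z f) x = _ from hρ _ _ _ _ x hx]; ring
    simp only [cov4]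
    linear_combination hpd - hs (fun f => Γ a b f x) (fun f => f) (fun _ => c) (fun _ => d)
        (fun _ => e)
      - hs (fun f => Γ a c f x) (fun _ => b) (fun f => f) (fun _ => d) (fun _ => e)
      - hs (fun f => Γ a d f x) (fun _ => b) (fun _ => c) (fun f => f) (fun _ => e)
      - hs (fun f => Γ a e f x) (fun _ => b) (fun _ => c) (fun _ => d) (fun f => f)
  have hcov : ∀ a b c d e, cov4 Γ a ρ b c d e x = cov3 Γ a (cov3 Γ b μ) c d e x
      - ∑ f, Γ a b f x * cov3 Γ f μ c d e x - cov4 Γ a (Rtri Γ σ) b c d e x := by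
    intro a b c d e
    have hpd : pd a (ρ b c d e) x = pd a (cov3 Γ b μ c d e) x - pd a (Rtri Γ σ b c d e) x :=
      pd_sub ((ContDiffOn.cov3 hU hΓ hμ b c d e).differentiableAt_of_isOpen hU hx)
        ((ContDiffOn.Rtri hU hΓ hσ b c d e).differentiableAt_of_isOpen hU hx) a
    rw [cov4, hpd, cov4, cov3]
    simp only [hρdef, mul_sub, Finset.sum_sub_distrib]
    ring
  have hQ : ∀ a b c d e, cov4 Γ a ρ b c d e x - cov4 Γ b ρ a c d e x =
      -(L a b c e d - L a b c d e) + L a b d c e - L a b e c d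
      - (2 / 3 * (2 * L d e b c a - L d e b a c) - 1 / 3 * (2 * L c d b e a - L c d b a e)
        + 1 / 3 * (2 * L c e b d a - L c e b a d))
      + (2 / 3 * (2 * L d e a c b - L d e a b c) - 1 / 3 * (2 * L c d a e b - L c d a b e)
        + 1 / 3 * (2 * L c e a d b - L c e a b d)) := by
    intro a b c d e
    have hricci := ricci_cov3 hU hΓ hμ hx a b c d e
    have htor : ∑ f, Γ a b f x * cov3 Γ f μ c d e x = ∑ f, Γ b a f x * cov3 Γ f μ c d e x :=
      Finset.sum_congr rfl fun f _ => by rw [hsym a b f x hx]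
    rw [hL₁, hL₂, hL₃] at hricci
    rw [hcov, hcov, cov4_Rtri hU hΓ hσ hx hR, cov4_Rtri hU hΓ hσ hx hR]
    simp only [hL₄]
    linear_combination hricci - htor
  have main := eq_of_skew_part_eq (X := fun a b c d e => cov4 Γ a ρ b c d e x) hA hB hX hQ a b c d e
  rw [Rdia]
  simp only [hL₁, hL₅, hL₆]
  exact main

/-- The prolonged variable `μ` of a Killing 2-tensor `σ`. -/
def killingMu (Γ : Fin n → Fin n → Fin n → (Fin n → ℝ) → ℝ)
    (σ : Fin n → Fin n → (Fin n → ℝ) → ℝ) (b c d : Fin n) (x : Fin n → ℝ) : ℝ :=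
  -(1 / 3) * (cov2 Γ d σ b c x - cov2 Γ c σ b d x)

/-- The prolonged variable `ρ` of a Killing 2-tensor `σ`. -/
def killingRho (Γ : Fin n → Fin n → Fin n → (Fin n → ℝ) → ℝ)
    (σ : Fin n → Fin n → (Fin n → ℝ) → ℝ) (a b c d : Fin n) (x : Fin n → ℝ) : ℝ :=
  cov3 Γ a (killingMu Γ σ) b c d x - Rtri Γ σ a b c d x

theorem cov2_symm (hU : IsOpen U) (hσ : ∀ b c, ∀ y ∈ U, σ b c y = σ c b y) (hx : x ∈ U)
    (a b c : Fin n) : cov2 Γ a σ b c x = cov2 Γ a σ c b x := by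
  have hs : ∀ (i j : Fin n), ∑ e, Γ a i e x * σ e j x = ∑ e, Γ a i e x * σ j e x :=
    fun i j => Finset.sum_congr rfl fun e _ => by rw [hσ e j x hx]
  rw [cov2, cov2, pd_congr hU (fun y hy => hσ b c y hy) hx a, hs, hs]
  ring

theorem cov3_symm_of_symm (hU : IsOpen U) (h : ∀ b c d, ∀ y ∈ U, μ b c d y = μ b d c y)
    (hx : x ∈ U) (a b c d : Fin n) : cov3 Γ a μ b c d x = cov3 Γ a μ b d c x := by
  have hs : ∀ (p : Fin n → ℝ) (u v w : Fin n → Fin n),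
      ∑ f, p f * μ (u f) (v f) (w f) x = ∑ f, p f * μ (u f) (w f) (v f) x :=
    fun p u v w => Finset.sum_congr rfl fun f _ => by rw [h _ _ _ x hx]
  rw [cov3, cov3]
  linear_combination pd_congr hU (h b c d) hx a
    - hs (fun f => Γ a b f x) (fun f => f) (fun _ => c) (fun _ => d)
    - hs (fun f => Γ a c f x) (fun _ => b) (fun f => f) (fun _ => d)
    - hs (fun f => Γ a d f x) (fun _ => b) (fun _ => c) (fun f => f)

theorem cov3_killingMu (hU : IsOpen U) (hΓ : ∀ a b c, ContDiffOn ℝ (⊤ : ℕ∞) (Γ a b c) U)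
    (hσ : ∀ b c, ContDiffOn ℝ (⊤ : ℕ∞) (σ b c) U) (hx : x ∈ U) (a b c d : Fin n) :
    cov3 Γ a (killingMu Γ σ) b c d x =
      -(1 / 3) * (cov3 Γ a (fun i j k => cov2 Γ i σ j k) d b c x
        - cov3 Γ a (fun i j k => cov2 Γ i σ j k) c b d x) := by
  have dN : ∀ i j k, DifferentiableAt ℝ (cov2 Γ i σ j k) x := fun i j k =>
    (ContDiffOn.cov2 hU hΓ hσ i j k).differentiableAt_of_isOpen hU hx
  have hpd : pd a (killingMu Γ σ b c d) x =
      -(1 / 3) * (pd a (cov2 Γ d σ b c) x - pd a (cov2 Γ c σ b d) x) := by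
    rw [← pd_sub (dN d b c) (dN c b d), ← pd_const_mul ((dN d b c).fun_sub (dN c b d))]
    rfl
  have hs : ∀ p u v : Fin n → ℝ, ∑ f, p f * (-(1 / 3) * (u f - v f)) =
      -(1 / 3) * (∑ f, p f * u f - ∑ f, p f * v f) := by
    intro p u v
    rw [← Finset.sum_sub_distrib, Finset.mul_sum]
    exact Finset.sum_congr rfl fun _ _ => by ring
  simp only [cov3, hpd]
  simp only [killingMu, hs]
  ring

theorem killingRho_skew (hU : IsOpen U) (hΓ : ∀ a b c, ContDiffOn ℝ (⊤ : ℕ∞) (Γ a b c) U)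
    (hsym : ∀ a b c, ∀ y ∈ U, Γ a b c y = Γ b a c y)
    (hσ : ∀ b c, ContDiffOn ℝ (⊤ : ℕ∞) (σ b c) U)
    (hσsym : ∀ b c, ∀ y ∈ U, σ b c y = σ c b y)
    (hkill : ∀ a b c, ∀ y ∈ U, cov2 Γ a σ b c y + cov2 Γ b σ c a y + cov2 Γ c σ a b y = 0)
    (hx : x ∈ U) (a b c d : Fin n) :
    killingRho Γ σ a b c d x = -killingRho Γ σ b a c d x := by
  let N : Fin n → Fin n → Fin n → (Fin n → ℝ) → ℝ := fun i j k => cov2 Γ i σ j k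
  have hN : ∀ i j k, N i j k = cov2 Γ i σ j k := fun _ _ _ => rfl
  have dN : ∀ i j k, DifferentiableAt ℝ (N i j k) x := fun i j k =>
    (ContDiffOn.cov2 hU hΓ hσ i j k).differentiableAt_of_isOpen hU hx
  let P : Fin n → Fin n → Fin n → Fin n → ℝ := fun i j k l => ∑ e, curv Γ i j e k x * σ l e x
  have hA : ∀ i j k l, P i j k l + P j i k l = 0 := by
    intro i j k l
    simp only [P, ← Finset.sum_add_distrib]
    refine Finset.sum_eq_zero fun f _ => ?_
    rw [curv_antisymm]
    ring
  have hB : ∀ i j k l, P i j k l + P j k i l + P k i j l = 0 := by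
    intro i j k l
    simp only [P, ← Finset.sum_add_distrib]
    refine Finset.sum_eq_zero fun f _ => ?_
    linear_combination σ l f x * curv_bianchi hU hsym hx i j k f
  have hNsym : ∀ i j k, ∀ y ∈ U, N i j k y = N i k j y := fun i j k y hy =>
    cov2_symm hU hσsym hy i j k
  have hS : ∀ a b c d, cov3 Γ a N b c d x = cov3 Γ a N b d c x :=
    fun a => cov3_symm_of_symm hU hNsym hx a
  have hK : ∀ a b c d, cov3 Γ a N b c d x + cov3 Γ a N c d b x + cov3 Γ a N d b c x = 0 := by
    intro a b c d
    have hpd : pd a (N b c d) x = -(pd a (N c d b) x + pd a (N d b c) x) := by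
      rw [← pd_add (dN c d b) (dN d b c), ← pd_neg]
      refine pd_congr hU (fun y hy => ?_) hx a
      linear_combination hkill b c d y hy
    have hs : ∀ (p : Fin n → ℝ) (u v w : Fin n → Fin n),
        ∑ f, p f * N (u f) (v f) (w f) x + ∑ f, p f * N (v f) (w f) (u f) x
          + ∑ f, p f * N (w f) (u f) (v f) x = 0 := by
      intro p u v w
      rw [← Finset.sum_add_distrib, ← Finset.sum_add_distrib]
      refine Finset.sum_eq_zero fun f _ => ?_
      linear_combination p f * hkill (u f) (v f) (w f) x hx
    rw [cov3, cov3, cov3]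
    linear_combination hpd
      - hs (fun f => Γ a b f x) (fun f => f) (fun _ => c) (fun _ => d)
      - hs (fun f => Γ a c f x) (fun _ => b) (fun f => f) (fun _ => d)
      - hs (fun f => Γ a d f x) (fun _ => b) (fun _ => c) (fun f => f)
  have hC : ∀ a b c d, cov3 Γ a N b c d x - cov3 Γ b N a c d x = -P a b c d - P a b d c := by
    intro a b c d
    have hsplit : ∀ a b, cov3 Γ a N b c d x =
        cov2 Γ a (cov2 Γ b σ) c d x - ∑ f, Γ a b f x * cov2 Γ f σ c d x := by
      intro a b
      simp only [cov3, hN]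
      rw [cov2]
      ring
    have htor : ∑ f, Γ a b f x * cov2 Γ f σ c d x = ∑ f, Γ b a f x * cov2 Γ f σ c d x :=
      Finset.sum_congr rfl fun f _ => by rw [hsym a b f x hx]
    have hP : ∑ e, curv Γ a b e c x * σ e d x = P a b c d :=
      Finset.sum_congr rfl fun e _ => by rw [hσsym e d x hx]
    have hricci := ricci_cov2 hU hΓ hσ hx a b c d
    rw [hP] at hricci
    rw [hsplit, hsplit]
    linear_combination hricci - htor
  have main := killing_hessian_skew (D := fun a b c d => cov3 Γ a N b c d x) hA hB hS hK hC a b c d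
  rw [killingRho, killingRho, cov3_killingMu hU hΓ hσ hx, cov3_killingMu hU hΓ hσ hx]
  exact main

theorem KTwoProlonged.of_killing (hU : IsOpen U)
    (hΓ : ∀ a b c, ContDiffOn ℝ (⊤ : ℕ∞) (Γ a b c) U)
    (hsym : ∀ a b c, ∀ y ∈ U, Γ a b c y = Γ b a c y)
    (hR : ∀ a b c d e, ∀ y ∈ U, covR Γ a b c d e y = 0)
    (hσ : ∀ b c, ContDiffOn ℝ (⊤ : ℕ∞) (σ b c) U)
    (hσsym : ∀ b c, ∀ y ∈ U, σ b c y = σ c b y)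
    (hkill : ∀ a b c, ∀ y ∈ U, cov2 Γ a σ b c y + cov2 Γ b σ c a y + cov2 Γ c σ a b y = 0) :
    KTwoProlonged U Γ σ (killingMu Γ σ) (killingRho Γ σ) := by
  have hNsym : ∀ i j k, ∀ y ∈ U, cov2 Γ i σ j k y = cov2 Γ i σ k j y := fun i j k y hy =>
    cov2_symm hU hσsym hy i j k
  have hμ : ∀ b c d, ContDiffOn ℝ (⊤ : ℕ∞) (killingMu Γ σ b c d) U := fun b c d =>
    contDiffOn_const.mul
      ((ContDiffOn.cov2 hU hΓ hσ d b c).sub (ContDiffOn.cov2 hU hΓ hσ c b d))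
  have hskew : ∀ b c d, ∀ y ∈ U, killingMu Γ σ b c d y = -killingMu Γ σ b d c y := by
    intro b c d y _
    simp only [killingMu]
    ring
  have hcyc : ∀ b c d, ∀ y ∈ U,
      killingMu Γ σ b c d y + killingMu Γ σ c d b y + killingMu Γ σ d b c y = 0 := by
    intro b c d y hy
    simp only [killingMu]
    linear_combination (-(1 / 3) : ℝ) *
      (hNsym d b c y hy + hNsym b c d y hy + hNsym c d b y hy)
  have hσμ : ∀ a b c, ∀ y ∈ U,
      cov2 Γ a σ b c y + killingMu Γ σ b c a y + killingMu Γ σ c b a y = 0 := by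
    intro a b c y hy
    simp only [killingMu]
    linear_combination (1 / 3 : ℝ) * (hkill a b c y hy + hNsym a b c y hy + hNsym c b a y hy)
  have hρ : ∀ a b c d, ∀ y ∈ U, killingRho Γ σ a b c d y = -killingRho Γ σ b a c d y :=
    fun a b c d y hy => killingRho_skew hU hΓ hsym hσ hσsym hkill hy a b c d
  refine ⟨hμ, fun a b c d => (ContDiffOn.cov3 hU hΓ hμ a b c d).sub
      (ContDiffOn.Rtri hU hΓ hσ a b c d), hskew, hcyc, hρ, ?_, ?_, hσμ, ?_, ?_⟩
  · intro a b c d y hy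
    have hP : ∑ e, curv Γ c d e a y * σ b e y = -∑ e, curv Γ d c e a y * σ b e y := by
      rw [← Finset.sum_neg_distrib]
      exact Finset.sum_congr rfl fun e _ => by rw [curv_antisymm]; ring
    rw [killingRho, killingRho, cov3_killingMu hU hΓ hσ hy, cov3_killingMu hU hΓ hσ hy, Rtri, Rtri]
    linear_combination (-(2 / 3) : ℝ) * hP
  · intro a b c d y hy
    have hP : ∀ i j l, ∑ e, curv Γ i j e a y * σ l e y = -∑ e, curv Γ j i e a y * σ l e y := by
      intro i j l
      rw [← Finset.sum_neg_distrib]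
      exact Finset.sum_congr rfl fun e _ => by rw [curv_antisymm]; ring
    have hs : ∀ i j k, cov3 Γ a (fun i j k => cov2 Γ i σ j k) i j k y =
        cov3 Γ a (fun i j k => cov2 Γ i σ j k) i k j y :=
      cov3_symm_of_symm hU hNsym hy a
    simp only [killingRho, cov3_killingMu hU hΓ hσ hy, Rtri]
    linear_combination (-(1 / 3) : ℝ) * (hs d b c + hs b c d + hs c d b)
      - (1 / 3 : ℝ) * (hP b c d + hP c d b + hP b d c)
  · intro a b c d y _
    rw [killingRho]
    ring
  · intro a b c d e y hy
    exact cov4_eq_Rdia hU hΓ hsym hσ hμ hy (fun a b c d e => hR a b c d e y hy)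
      (fun b c d => hskew b c d y hy) (fun b c d => hcyc b c d y hy)
      (fun a b c => hσμ a b c y hy) hρ a b c d e

theorem KTwoProlonged.mu_eq {ρ : Fin n → Fin n → Fin n → Fin n → (Fin n → ℝ) → ℝ}
    (h : KTwoProlonged U Γ σ μ ρ) (hx : x ∈ U) (b c d : Fin n) :
    μ b c d x = killingMu Γ σ b c d x := by
  obtain ⟨-, -, hskew, hcyc, -, -, -, hσμ, -, -⟩ := h
  rw [killingMu]
  linear_combination (1 / 3 : ℝ) * (hσμ d b c x hx - hσμ c b d x hx + hcyc b c d x hx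
    + hskew b c d x hx - hskew c b d x hx)

theorem KTwoProlonged.rho_eq {ρ : Fin n → Fin n → Fin n → Fin n → (Fin n → ℝ) → ℝ}
    (h : KTwoProlonged U Γ σ μ ρ) (hU : IsOpen U) (hx : x ∈ U) (a b c d : Fin n) :
    ρ a b c d x = killingRho Γ σ a b c d x := by
  have hμ : ∀ b c d, ∀ y ∈ U, μ b c d y = killingMu Γ σ b c d y := fun b c d y hy =>
    h.mu_eq hy b c d
  obtain ⟨-, -, -, -, -, -, -, -, hμρ, -⟩ := h
  have hcov : cov3 Γ a μ b c d x = cov3 Γ a (killingMu Γ σ) b c d x := by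
    simp only [cov3, hμ _ _ _ x hx, pd_congr hU (hμ b c d) hx a]
  rw [killingRho, ← hcov, hμρ a b c d x hx]
  ring

theorem KTwoProlonged.cyclic_cov2_eq_zero
    {ρ : Fin n → Fin n → Fin n → Fin n → (Fin n → ℝ) → ℝ}
    (h : KTwoProlonged U Γ σ μ ρ) (hx : x ∈ U) (a b c : Fin n) :
    cov2 Γ a σ b c x + cov2 Γ b σ c a x + cov2 Γ c σ a b x = 0 := by
  obtain ⟨-, -, hskew, -, -, -, -, hσμ, -, -⟩ := h
  linear_combination hσμ a b c x hx + hσμ b c a x hx + hσμ c a b x hx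
    - hskew b c a x hx - hskew c a b x hx - hskew a b c x hx

end Prolongation

/-- **Prolongation of Killing 2-tensors on an affine locally symmetric space.**
A smooth symmetric 2-tensor `σ` is a Killing 2-tensor iff there exist (unique) smooth
tensors `μ_{bcd}` and `ρ_{bcde}` with the stated symmetries satisfying the
prolongation equations (i), (ii), (iii). -/
theorem killing_two_tensors_prolongation
    {n : ℕ} (hn : 1 ≤ n) (U : Set (Fin n → ℝ)) (hU : IsOpen U)
    (Γ : Fin n → Fin n → Fin n → (Fin n → ℝ) → ℝ)
    (hΓsmooth : ∀ a b c, ContDiffOn ℝ (⊤ : ℕ∞) (Γ a b c) U)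
    (hΓsym : ∀ a b c, ∀ x ∈ U, Γ a b c x = Γ b a c x)
    (hlocsym : ∀ a b c d e, ∀ x ∈ U, covR Γ a b c d e x = 0)
    (σ : Fin n → Fin n → (Fin n → ℝ) → ℝ)
    (hσsmooth : ∀ b c, ContDiffOn ℝ (⊤ : ℕ∞) (σ b c) U)
    (hσsym : ∀ b c, ∀ x ∈ U, σ b c x = σ c b x) :
    ((∀ a b c, ∀ x ∈ U,
        cov2 Γ a σ b c x + cov2 Γ b σ c a x + cov2 Γ c σ a b x +
          cov2 Γ a σ c b x + cov2 Γ b σ a c x + cov2 Γ c σ b a x = 0) ↔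
      ∃ μ : Fin n → Fin n → Fin n → (Fin n → ℝ) → ℝ,
        ∃ ρ : Fin n → Fin n → Fin n → Fin n → (Fin n → ℝ) → ℝ,
          KTwoProlonged U Γ σ μ ρ) ∧
    (∀ μ₁ ρ₁ μ₂ ρ₂, KTwoProlonged U Γ σ μ₁ ρ₁ → KTwoProlonged U Γ σ μ₂ ρ₂ →
      (∀ b c d, ∀ x ∈ U, μ₁ b c d x = μ₂ b c d x) ∧
      (∀ b c d e, ∀ x ∈ U, ρ₁ b c d e x = ρ₂ b c d e x)) := by
  refine ⟨⟨fun h => ?_, ?_⟩, fun μ₁ ρ₁ μ₂ ρ₂ h₁ h₂ => ⟨fun b c d x hx => ?_,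
    fun b c d e x hx => ?_⟩⟩
  · refine ⟨_, _, KTwoProlonged.of_killing hU hΓsmooth hΓsym hlocsym hσsmooth hσsym
      fun a b c x hx => ?_⟩
    linear_combination (1 / 2 : ℝ) * (h a b c x hx + cov2_symm hU hσsym hx a b c
      + cov2_symm hU hσsym hx b c a + cov2_symm hU hσsym hx c a b)
  · rintro ⟨μ, ρ, h⟩ a b c x hx
    linear_combination h.cyclic_cov2_eq_zero hx a b c + h.cyclic_cov2_eq_zero hx a c b
  · rw [h₁.mu_eq hx, h₂.mu_eq hx]
  · rw [h₁.rho_eq hU hx, h₂.rho_eq hU hx]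

end
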